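/- Let S be a maximal m-rigid set of (m+1)-diagonals of P_{n,m} containing a short diagonal {a_1, a_1+m}. Then for every i with 1 ≤ i ≤ m, the vertices a_1+m+i and a_1−i lie on no diagonal of S (they are isolated). -/

import Mathlib

namespace PaperTiling

variable {M : ℕ}

/-- `[i,j]`: the number of vertices encountered travelling clockwise from `i` to `j`, inclusive. -/
def cnt (i j : ZMod M) : ℕ := (j - i).val + 1

/-- `C(v₁,…,v_r)`: the entries are pairwise distinct and occur in this clockwise cyclic order. -/
def CW (l : List (ZMod M)) : Prop :=
  l.Nodup ∧ ((l.zip (l.rotate 1)).map fun p => (p.2 - p.1).val).sum = M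

/-- Two diagonals cross. -/
def Crosses (d e : Sym2 (ZMod M)) : Prop :=
  ∃ a1 b1 a2 b2 : ZMod M, d = s(a1, a2) ∧ e = s(b1, b2) ∧ CW [a1, b1, a2, b2]

/-- `d` is an `(m+1)`-diagonal. -/
def IsMDiag (m : ℕ) (d : Sym2 (ZMod M)) : Prop :=
  ¬ d.IsDiag ∧ ∀ i j : ZMod M, d = s(i, j) → (m + 1) ∣ cnt i j

/-- Short diagonal. -/
def IsShort (m : ℕ) (d : Sym2 (ZMod M)) : Prop :=
  ∃ v : ZMod M, d = s(v, v + (m : ZMod M))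

/-- Long diagonal. -/
def IsLong (m : ℕ) (d : Sym2 (ZMod M)) : Prop := IsMDiag m d ∧ ¬ IsShort m d

/-- The shift `Σ^k`. -/
def shiftD (k : ℕ) (d : Sym2 (ZMod M)) : Sym2 (ZMod M) :=
  d.map (fun v => v + (k : ZMod M))

/-- `a` and `b` are `k`-neighbours. -/
def Nbr (k : ℕ) (a b : Sym2 (ZMod M)) : Prop :=
  a ≠ b ∧ ¬ Crosses a b ∧ ∃ v ∈ a, ((v + (k : ZMod M)) ∈ b ∨ (v - (k : ZMod M)) ∈ b)

/-- The Ext-hammock condition `E_k(b,a)`. -/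
def Ek (m k : ℕ) (b a : Sym2 (ZMod M)) : Prop :=
  (Nbr k a b ∧ ∃ v ∈ a, (v + (k : ZMod M)) ∈ b) ∨
  (∃ a1 b1 a2 b2 : ZMod M, a = s(a1, a2) ∧ b = s(b1, b2) ∧ CW [a1, b1, a2, b2] ∧
    (∃ x : ℕ, 1 ≤ x ∧ cnt a1 b1 = x * (m + 1) + k) ∧
    (∃ x : ℕ, 1 ≤ x ∧ cnt a2 b2 = x * (m + 1) + k)) ∨
  b = shiftD k a

/-- `S` is `m`-rigid. -/
def MRigid (m : ℕ) (S : Set (Sym2 (ZMod M))) : Prop :=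
  ∀ a ∈ S, ∀ b ∈ S, ∀ k : ℕ, 1 ≤ k → k ≤ m → ¬ Ek m k b a

/-- `S` is maximal `m`-rigid (among sets of `(m+1)`-diagonals). -/
def MaxMRigid (m : ℕ) (S : Set (Sym2 (ZMod M))) : Prop :=
  (∀ d ∈ S, IsMDiag m d) ∧ MRigid m S ∧
  ∀ d : Sym2 (ZMod M), IsMDiag m d → d ∉ S → ¬ MRigid m (insert d S)

/-- `v` lies on no diagonal of `S`. -/
def Isolated (S : Set (Sym2 (ZMod M))) (v : ZMod M) : Prop := ∀ d ∈ S, v ∉ d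

/-- The graph of `S`. -/
def graphOf (S : Set (Sym2 (ZMod M))) : SimpleGraph (ZMod M) := SimpleGraph.fromEdgeSet S

/-- The induced subgraph of the graph of `S` on non-isolated vertices is connected. -/
def ConnectedSet (S : Set (Sym2 (ZMod M))) : Prop :=
  ((graphOf S).induce {v : ZMod M | ¬ Isolated S v}).Connected

/-- A tiling: a set of pairwise noncrossing diagonals. -/
def IsTiling (S : Set (Sym2 (ZMod M))) : Prop :=
  (∀ d ∈ S, ¬ d.IsDiag) ∧ ∀ d ∈ S, ∀ e ∈ S, ¬ Crosses d e

/-- The tile of `S` adjacent to the diagonal `{a,b}` on the side of the clockwise arc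
from `a` to `b`. -/
def tileAt (S : Set (Sym2 (ZMod M))) (a b : ZMod M) : Set (ZMod M) :=
  {v | cnt a v ≤ cnt a b ∧
    ∀ c e : ZMod M, s(c, e) ∈ S → s(c, e) ≠ s(a, b) →
      cnt a c ≤ cnt a e → cnt a e ≤ cnt a b →
      ¬ (cnt a c < cnt a v ∧ cnt a v < cnt a e)}

def IsTile (S : Set (Sym2 (ZMod M))) (T : Set (ZMod M)) : Prop :=
  ∃ a b : ZMod M, s(a, b) ∈ S ∧ T = tileAt S a b

/-- `d` is a bounding diagonal of the tile `T`. -/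
def IsBounding (S : Set (Sym2 (ZMod M))) (T : Set (ZMod M)) (d : Sym2 (ZMod M)) : Prop :=
  d ∈ S ∧ ∀ v ∈ d, v ∈ T

/-- The length `ℓ(T)` of a tile: the number of its bounding diagonals. -/
noncomputable def tileLen (S : Set (Sym2 (ZMod M))) (T : Set (ZMod M)) : ℕ :=
  {d | IsBounding S T d}.ncard

/-- `v` is strictly clockwise between `p` and `q`. -/
def StrictIn (p q v : ZMod M) : Prop := 1 < cnt p v ∧ cnt p v < cnt p q

/-- `(p,q)` is an open boundary of the tile `T`. -/
def IsOpenBdry (S : Set (Sym2 (ZMod M))) (T : Set (ZMod M)) (p q : ZMod M) : Prop :=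
  p ≠ q ∧ p ∈ T ∧ q ∈ T ∧
  (∃ d, IsBounding S T d ∧ p ∈ d) ∧ (∃ d, IsBounding S T d ∧ q ∈ d) ∧
  (∀ v : ZMod M, StrictIn p q v → v ∈ T ∧ Isolated S v) ∧
  (∀ d, IsBounding S T d → d ≠ s(p, q) → ∀ v ∈ d, ¬ StrictIn p q v)

def IsOpenTile (S : Set (Sym2 (ZMod M))) (T : Set (ZMod M)) : Prop :=
  ∃ p q, IsOpenBdry S T p q

/-- Tile of type `(ℓ, b)` with `b ≥ 1`. -/
def HasOpenType (S : Set (Sym2 (ZMod M))) (T : Set (ZMod M)) (l b : ℕ) : Prop :=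
  tileLen S T = l ∧ ∃ p q, IsOpenBdry S T p q ∧ cnt p q - 1 = b

/-- Tile of type `(ℓ, 0)`. -/
def HasClosedType (S : Set (Sym2 (ZMod M))) (T : Set (ZMod M)) (l : ℕ) : Prop :=
  tileLen S T = l ∧ ¬ IsOpenTile S T

/-- The list of possible tile types from Proposition 2.9. -/
def GoodTiles (m : ℕ) (S : Set (Sym2 (ZMod M))) : Prop :=
  ∀ T : Set (ZMod M), IsTile S T →
    (∃ k, 1 ≤ k ∧ k ≤ m + 1 ∧ HasOpenType S T k (m + k - 1)) ∨
    (tileLen S T = m + 2 ∧ ∃ p q, IsOpenBdry S T p q ∧ cnt p q - 1 = 2 * m + 1 ∧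
      ∃ d, IsBounding S T d ∧ (p ∈ d ∨ q ∈ d) ∧ IsShort m d) ∨
    HasOpenType S T 1 (2 * m + 1) ∨
    (tileLen S T = m + 3 ∧ ∃ p q, IsOpenBdry S T p q ∧ cnt p q - 1 = m + 1 ∧
      ∀ d, IsBounding S T d → (p ∈ d ∨ q ∈ d) → IsShort m d) ∨
    HasClosedType S T (m + 3)

/-- A quiver (arrow relation) with a set of length-two relation paths. -/
structure GPair (V : Type) where
  Arr : V → V → Prop
  Rel : V → V → V → Prop

namespace GPair

variable {V : Type} (G : GPair V)

def IsGentle : Prop :=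
  (∀ x y z, G.Rel x y z → G.Arr x y ∧ G.Arr y z) ∧
  (∀ x, ¬ G.Arr x x) ∧
  (∀ x y, G.Arr x y → ¬ G.Arr y x) ∧
  (∀ x, {y | G.Arr x y}.encard ≤ 2) ∧
  (∀ x, {y | G.Arr y x}.encard ≤ 2) ∧
  (∀ x y, G.Arr x y → {z | G.Arr y z ∧ ¬ G.Rel x y z}.encard ≤ 1) ∧
  (∀ x y, G.Arr x y → {w | G.Arr w x ∧ ¬ G.Rel w x y}.encard ≤ 1) ∧
  (∀ x y, G.Arr x y → {z | G.Arr y z ∧ G.Rel x y z}.encard ≤ 1) ∧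
  (∀ x y, G.Arr x y → {w | G.Arr w x ∧ G.Rel w x y}.encard ≤ 1)

/-- The underlying undirected graph is connected. -/
def Conn : Prop := (SimpleGraph.fromRel G.Arr).Connected

def OrientedCycle (r : ℕ) (v : ZMod r → V) : Prop :=
  3 ≤ r ∧ Function.Injective v ∧ ∀ i : ZMod r, G.Arr (v i) (v (i + 1))

def UndirCycle (r : ℕ) (v : ZMod r → V) : Prop :=
  3 ≤ r ∧ Function.Injective v ∧ ∀ i : ZMod r, G.Arr (v i) (v (i + 1)) ∨ G.Arr (v (i + 1)) (v i)

/-- All cycles are oriented and relation-full. -/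
def CyclesOrientedFull : Prop :=
  (∀ (r : ℕ) (v : ZMod r → V), G.UndirCycle r v →
    (∀ i, G.Arr (v i) (v (i + 1))) ∨ ∀ i, G.Arr (v (i + 1)) (v i)) ∧
  ∀ (r : ℕ) (v : ZMod r → V), G.OrientedCycle r v →
    ∀ i : ZMod r, G.Rel (v i) (v (i + 1)) (v (i + 2))

/-- The valency of a vertex: the number of arrows incident with it. -/
noncomputable def valency (x : V) : ℕ∞ := {y | G.Arr x y}.encard + {y | G.Arr y x}.encard

/-- A (non-trivial) permitted path, recorded by its list of vertices. -/
def PermPath (l : List V) : Prop :=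
  2 ≤ l.length ∧ l.Chain' G.Arr ∧ ∀ x y z : V, [x, y, z] <:+: l → ¬ G.Rel x y z

/-- A (non-trivial) forbidden path, recorded by its list of vertices. -/
def ForbPath (l : List V) : Prop :=
  2 ≤ l.length ∧ l.Chain' G.Arr ∧ (l.zip l.tail).Nodup ∧
    ∀ x y z : V, [x, y, z] <:+: l → G.Rel x y z

def TrivPermVtx (v : V) : Prop :=
  {y | G.Arr v y}.Subsingleton ∧ {y | G.Arr y v}.Subsingleton ∧
  ∀ x y, G.Arr x v → G.Arr v y → ¬ G.Rel x v y

def TrivForbVtx (v : V) : Prop :=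
  {y | G.Arr v y}.Subsingleton ∧ {y | G.Arr y v}.Subsingleton ∧
  ∀ x y, G.Arr x v → G.Arr v y → G.Rel x v y

/-- A permitted thread: a maximal permitted path, or a trivial permitted thread `[v]`. -/
def PermThread (l : List V) : Prop :=
  (G.PermPath l ∧ (∀ w, ¬ G.PermPath (l ++ [w])) ∧ ∀ w, ¬ G.PermPath (w :: l)) ∨
  ∃ v, l = [v] ∧ G.TrivPermVtx v

/-- A forbidden thread: a maximal forbidden path, or a trivial forbidden thread `[v]`. -/
def ForbThread (l : List V) : Prop :=
  (G.ForbPath l ∧ (∀ w, ¬ G.ForbPath (l ++ [w])) ∧ ∀ w, ¬ G.ForbPath (w :: l)) ∨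
  ∃ v, l = [v] ∧ G.TrivForbVtx v

end GPair

/-- A thread is closed if it is a cycle. -/
def IsClosedList {V : Type} (l : List V) : Prop := 2 ≤ l.length ∧ l.head? = l.getLast?

/-- The length (number of arrows) of a thread. -/
def threadLen {V : Type} (l : List V) : ℕ := l.length - 1

/-- Number of occurrences of the vertex `v` along the thread `l`. -/
def occ {V : Type} [DecidableEq V] (l : List V) (v : V) : ℕ :=
  if 2 ≤ l.length ∧ l.head? = l.getLast? then l.dropLast.count v else l.count v

/-- Arrow of the tiling quiver arising from the tile `T`. -/
def QArrIn (S : Set (Sym2 (ZMod M))) (T : Set (ZMod M)) (α β : Sym2 (ZMod M)) : Prop :=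
  IsTile S T ∧ IsBounding S T α ∧ IsBounding S T β ∧
  ∃ x a b : ZMod M, α = s(x, a) ∧ β = s(x, b) ∧ cnt x a < cnt x b

def QArr (S : Set (Sym2 (ZMod M))) (α β : Sym2 (ZMod M)) : Prop := ∃ T, QArrIn S T α β

def QRel (S : Set (Sym2 (ZMod M))) (α β γ : Sym2 (ZMod M)) : Prop :=
  ∃ T, QArrIn S T α β ∧ QArrIn S T β γ

/-- The tiling-algebra pair `(Q_S, R_S)` of a tiling `S`. -/
def tilingPair (S : Set (Sym2 (ZMod M))) : GPair {d : Sym2 (ZMod M) // d ∈ S} where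
  Arr := fun α β => QArr S α.1 β.1
  Rel := fun α β γ => QRel S α.1 β.1 γ.1

/-- Isomorphism of pairs. -/
def GPair.Iso {V W : Type} (G : GPair V) (H : GPair W) : Prop :=
  ∃ e : V ≃ W, (∀ x y, G.Arr x y ↔ H.Arr (e x) (e y)) ∧
    ∀ x y z, G.Rel x y z ↔ H.Rel (e x) (e y) (e z)

/-- `l` is the fan at the marked point `v`: the list of all diagonals of `S` incident with
`v`, in clockwise order around `v`. -/
def IsFan (S : Set (Sym2 (ZMod M))) (v : ZMod M) (l : List {d : Sym2 (ZMod M) // d ∈ S}) :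
    Prop :=
  l.Nodup ∧ (∀ d : {d : Sym2 (ZMod M) // d ∈ S}, d ∈ l ↔ v ∈ d.1) ∧
  l.Pairwise fun d e => ∃ a b : ZMod M, d.1 = s(v, a) ∧ e.1 = s(v, b) ∧ cnt v a < cnt v b

/-- `F` is the forbidden thread ending at `t(H)` from the opposite direction to `H`. -/
def OppEnd {V : Type} (G : GPair V) (H F : List V) : Prop :=
  ∃ y : V, H.getLast? = some y ∧ F.getLast? = some y ∧
    ((∃ x w, [x, y] <:+ H ∧ [w, y] <:+ F ∧ x ≠ w) ∨
     (∃ w, [w, y] <:+ F ∧ (∀ u, G.Arr u y → u = w) ∧ ¬ ([w, y] <:+: H)) ∨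
     (F = [y] ∧ {u | G.Arr u y}.Subsingleton ∧ ∀ u, G.Arr u y → [u, y] <:+: H))

/-- `H` is the permitted thread starting at `s(F)` in the opposite direction to `F`. -/
def OppStart {V : Type} (G : GPair V) (F H : List V) : Prop :=
  ∃ y : V, F.head? = some y ∧ H.head? = some y ∧
    ((∃ x w, [y, x] <+: F ∧ [y, w] <+: H ∧ x ≠ w) ∨
     (∃ w, [y, w] <+: H ∧ (∀ u, G.Arr y u → u = w) ∧ ¬ ([y, w] <:+: F)) ∨
     (H = [y] ∧ {u | G.Arr y u}.Subsingleton ∧ ∀ u, G.Arr y u → [y, u] <:+: F))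

/-- The AG-successor relation on permitted threads. -/
def AGStep {V : Type} (G : GPair V) (H H' : List V) : Prop :=
  ∃ F, G.ForbThread F ∧ OppEnd G H F ∧ OppStart G F H'

/-- The sides of a tile: bounding diagonals together with boundary edges. -/
def sides (S : Set (Sym2 (ZMod M))) (T : Set (ZMod M)) : Set (Sym2 (ZMod M)) :=
  {d | IsBounding S T d} ∪ {d | ∃ v : ZMod M, d = s(v, v + 1) ∧ v ∈ T ∧ (v + 1) ∈ T}

/-- An `(m+3)`-angulation of a disc. -/
def IsAngulation (m : ℕ) (S : Set (Sym2 (ZMod M))) : Prop :=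
  IsTiling S ∧ (∀ v : ZMod M, s(v, v + 1) ∉ S) ∧
  ∀ T, IsTile S T → (sides S T).ncard = m + 3

theorem cw_rotate {a b c d : ZMod M} (h : CW [a, b, c, d]) : CW [b, c, d, a] := by
  obtain ⟨h1, h2⟩ := h
  refine ⟨?_, ?_⟩
  · simp only [List.nodup_cons, List.mem_cons, List.not_mem_nil] at h1 ⊢
    grind
  · simp at h2 ⊢
    omega

theorem crosses_symm {d e : Sym2 (ZMod M)} (h : Crosses d e) : Crosses e d := by
  obtain ⟨x, y, x', y', hd, he, hc⟩ := h
  exact ⟨y, x', y', x, he, hd.trans Sym2.eq_swap, cw_rotate hc⟩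

theorem dvd_cases {m u : ℕ} (h : (m + 1) ∣ u) (h0 : 0 < u) (h1 : u < 2 * (m + 1)) :
    u = m + 1 := by
  obtain ⟨c, rfl⟩ := h
  have hc : c = 1 := by
    rcases c with _ | _ | c
    · simp at h0
    · rfl
    · exfalso
      nlinarith
  simp [hc]

theorem val_add_sub {N : ℕ} [NeZero N] (a : ZMod N) {s t : ℕ} (h : s ≤ t) (ht : t < N) :
    ((a + (t : ZMod N)) - (a + (s : ZMod N))).val = t - s := by
  have : (a + (t : ZMod N)) - (a + (s : ZMod N)) = ((t - s : ℕ) : ZMod N) := by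
    push_cast [h]
    ring
  rw [this, ZMod.val_natCast, Nat.mod_eq_of_lt (by omega)]

theorem cross_inner {N m : ℕ} [NeZero N] (hmN : m < N) {a x y x' y' : ZMod N}
    (hx : x = a) (hx' : x' = a + (m : ZMod N)) (hc : CW [x, y, x', y']) :
    ∃ j : ℕ, 0 < j ∧ j < m ∧ y = a + (j : ZMod N) := by
  subst hx
  obtain ⟨h1, h2⟩ := hc
  simp only [List.nodup_cons, List.mem_cons, List.not_mem_nil] at h1
  have e : ∀ u v : ZMod N, u ≠ v → 0 < (v - u).val := by
    intro u v huv
    rcases Nat.eq_zero_or_pos (v - u).val with h | h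
    · rw [ZMod.val_eq_zero, sub_eq_zero] at h
      exact absurd h.symm huv
    · exact h
  have p1 := e x y (by grind)
  have p2 := e y x' (by grind)
  have p3 := e x' y' (by grind)
  have p4 := e y' x (by grind)
  simp at h2
  have hs : (x' - x).val = (y - x).val + (x' - y).val := by
    rw [← ZMod.val_add_of_lt (by omega)]
    congr 1
    ring
  have hm' : (x' - x).val = m := by
    rw [hx']
    simp [ZMod.val_natCast, Nat.mod_eq_of_lt hmN]
  refine ⟨(y - x).val, p1, by omega, ?_⟩
  simp

theorem cross_key {N m t : ℕ} [NeZero N] (a : ZMod N) (b : Sym2 (ZMod N)) (hb : IsMDiag m b)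
    (hc : Crosses s(a, a + (m : ZMod N)) b) (hw : a + (t : ZMod N) ∈ b) (h1 : m < t)
    (h2 : t < N) :
    ∃ j : ℕ, 0 < j ∧ j < m ∧ b = s(a + (j : ZMod N), a + (t : ZMod N)) ∧
      (m + 1) ∣ t - j + 1 ∧ (m + 1) ∣ N - t + j + 1 := by
  have main : ∃ j : ℕ, 0 < j ∧ j < m ∧ a + (j : ZMod N) ∈ b := by
    obtain ⟨x, y, x', y', hd, he, hcw⟩ := hc
    rw [Sym2.eq_iff] at hd
    rcases hd with ⟨hx, hx'⟩ | ⟨hx, hx'⟩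
    · obtain ⟨j, hj, hjm, rfl⟩ := cross_inner (by omega) hx.symm hx'.symm hcw
      exact ⟨j, hj, hjm, by simp [he]⟩
    · obtain ⟨j, hj, hjm, rfl⟩ :=
        cross_inner (by omega) hx.symm hx'.symm (cw_rotate (cw_rotate hcw))
      exact ⟨j, hj, hjm, by simp [he]⟩
  obtain ⟨j, hj, hjm, hjb⟩ := main
  have hv := val_add_sub a (s := j) (t := t) (by omega) h2
  have hne : a + (j : ZMod N) ≠ a + (t : ZMod N) := by
    intro h
    rw [h, sub_self, ZMod.val_zero] at hv
    omega
  have hbe : b = s(a + (j : ZMod N), a + (t : ZMod N)) :=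
    (Sym2.mem_and_mem_iff hne).1 ⟨hjb, hw⟩
  refine ⟨j, hj, hjm, hbe, ?_, ?_⟩
  · have := hb.2 _ _ hbe
    rwa [cnt, hv] at this
  · have := hb.2 _ _ (hbe.trans Sym2.eq_swap)
    have hv2 : ((a + (j : ZMod N)) - (a + (t : ZMod N))).val = N - t + j := by
      have e : (a + (j : ZMod N)) - (a + (t : ZMod N)) = ((N - t + j : ℕ) : ZMod N) := by
        push_cast [h2.le]
        simp
        ring
      rw [e, ZMod.val_natCast, Nat.mod_eq_of_lt (by omega)]
    rwa [cnt, hv2] at this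

/-- Lemma 2.3. If a maximal `m`-rigid set `S` contains the short diagonal
`{a₁, a₁+m}`, then the vertices `a₁+m+i` and `a₁-i` for `1 ≤ i ≤ m` are isolated. -/
theorem short_isolates (m n N : ℕ) (hm : 1 ≤ m) (hn : 2 ≤ n) (hN : N = (m + 1) * (n + 1) - 2)
    (S : Set (Sym2 (ZMod N))) (hmax : MaxMRigid m S)
    (a1 : ZMod N) (hshort : s(a1, a1 + (m : ZMod N)) ∈ S) :
    ∀ i : ℕ, 1 ≤ i → i ≤ m →
      Isolated S (a1 + (m : ZMod N) + (i : ZMod N)) ∧ Isolated S (a1 - (i : ZMod N)) := by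
  obtain ⟨hS, hR, -⟩ := hmax
  have hN3 : 3 * m + 1 ≤ N := by
    have : (m + 1) * 3 ≤ (m + 1) * (n + 1) := Nat.mul_le_mul_left _ (by omega)
    omega
  have : NeZero N := ⟨by omega⟩
  intro i hi him
  have notmem : ∀ t : ℕ, m < t → t < N →
      a1 + (t : ZMod N) ∉ s(a1, a1 + (m : ZMod N)) := by
    intro t h1 h2 h
    rw [Sym2.mem_iff] at h
    have v1 := val_add_sub a1 (s := 0) (t := t) (by omega) h2
    have v2 := val_add_sub a1 (s := m) (t := t) (by omega) h2
    rcases h with h | h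
    · rw [h] at v1
      simp at v1
      omega
    · rw [h] at v2
      simp at v2
      omega
  constructor
  · intro b hb hv
    have hv' : a1 + ((m + i : ℕ) : ZMod N) ∈ b := by
      push_cast
      rwa [← add_assoc]
    apply hR _ hshort b hb i hi him
    by_cases hc : Crosses s(a1, a1 + (m : ZMod N)) b
    · right; right
      obtain ⟨j, hj, hjm, hbe, hd, -⟩ :=
        cross_key a1 b (hS b hb) hc hv' (by omega) (by omega)
      have := dvd_cases hd (by omega) (by omega)
      obtain rfl : j = i := by omega
      rw [hbe]
      simp [shiftD, add_assoc]
    · left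
      refine ⟨⟨?_, hc, a1 + (m : ZMod N), by simp, Or.inl hv⟩, a1 + (m : ZMod N), by simp, hv⟩
      intro h
      exact notmem (m + i) (by omega) (by omega) (h ▸ hv')
  · intro b hb hv
    have hv' : a1 + ((N - i : ℕ) : ZMod N) ∈ b := by
      rw [Nat.cast_sub (by omega)]
      simpa [← sub_eq_add_neg] using hv
    apply hR b hb _ hshort i hi him
    by_cases hc : Crosses b s(a1, a1 + (m : ZMod N))
    · right; right
      obtain ⟨j, hj, hjm, hbe, -, hd⟩ :=
        cross_key a1 b (hS b hb) (crosses_symm hc) hv' (by omega) (by omega)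
      have := dvd_cases hd (by omega) (by omega)
      obtain rfl : m = j + i := by omega
      rw [hbe, Nat.cast_sub (by omega)]
      simp [shiftD, add_assoc]
    · left
      refine ⟨⟨?_, hc, a1 - (i : ZMod N), hv, Or.inl (by simp)⟩, a1 - (i : ZMod N), hv, by simp⟩
      intro h
      exact notmem (N - i) (by omega) (by omega) (h ▸ hv')
end PaperTiling
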